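/- arXiv:1207.5780 — 2 statements merged into one kernel-verified Lean document; each statement's English description precedes it below -/
import Mathlib

section
/- Let p : I → k be such that for every i, if p_i is an integer then p_i is a negative integer. Then B(p) is isomorphic to P(p) as left A-modules. -/
set_option synthInstance.maxHeartbeats 1000000
set_option maxHeartbeats 4000000

noncomputable section

open MvPolynomial

universe u v

variable (k : Type u) (I : Type v) [Field k]

/-- Multiplication by the variable `x i` on the polynomial algebra `B`. -/
def Xop (i : I) : Module.End k (MvPolynomial I k) :=
  LinearMap.mulLeft k (MvPolynomial.X i)

/-- The partial derivative `∂/∂x i` on the polynomial algebra `B`. -/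
def Yop (i : I) : Module.End k (MvPolynomial I k) :=
  (MvPolynomial.pderiv i).toLinearMap

/-- The infinite Weyl algebra `A`: the subalgebra of `Module.End k B` generated by
all `X i` and `Y i`. -/
def Weyl : Subalgebra k (Module.End k (MvPolynomial I k)) :=
  Algebra.adjoin k (Set.range (Xop k I) ∪ Set.range (Yop k I))

instance : Ring (Weyl k I) := inferInstance
instance : Algebra k (Weyl k I) := inferInstance

/-- `X i` as an element of the Weyl algebra. -/
def XA (i : I) : Weyl k I :=
  ⟨Xop k I i, Algebra.subset_adjoin (Set.mem_union_left _ ⟨i, rfl⟩)⟩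

/-- `Y i` as an element of the Weyl algebra. -/
def YA (i : I) : Weyl k I :=
  ⟨Yop k I i, Algebra.subset_adjoin (Set.mem_union_right _ ⟨i, rfl⟩)⟩

/-- `t i = X i * Y i` as an element of the Weyl algebra. -/
def tA (i : I) : Weyl k I := XA k I i * YA k I i

/-- The shift operator `S i : e_v ↦ e_{v + δ i}` on the free module `(I →₀ ℤ) →₀ k`. -/
def Sop (i : I) : Module.End k ((I →₀ ℤ) →₀ k) :=
  Finsupp.lmapDomain k k (fun v => v + Finsupp.single i 1)

/-- The twisted derivative operator `D i : e_v ↦ (p i + v i) • e_{v - δ i}`. -/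
def Dop (p : I → k) (i : I) : Module.End k ((I →₀ ℤ) →₀ k) :=
  Finsupp.lsum k fun v =>
    LinearMap.toSpanSingleton k ((I →₀ ℤ) →₀ k)
      ((p i + ((v i : ℤ) : k)) • Finsupp.single (v - Finsupp.single i 1) (1 : k))

/-- The space `V = (I →₀ ℤ) →₀ k` regarded as a module over the Weyl algebra through a
homomorphism `ρ : A →ₐ[k] End_k V`; this is the module `B(p)` when `ρ = ρ_p`. -/
def BMod (ρ : Weyl k I →ₐ[k] Module.End k ((I →₀ ℤ) →₀ k)) : Type (max u v) :=
  (I →₀ ℤ) →₀ k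

variable {k I} in
instance (ρ : Weyl k I →ₐ[k] Module.End k ((I →₀ ℤ) →₀ k)) : AddCommGroup (BMod k I ρ) :=
  inferInstanceAs (AddCommGroup ((I →₀ ℤ) →₀ k))

variable {k I} in
instance (ρ : Weyl k I →ₐ[k] Module.End k ((I →₀ ℤ) →₀ k)) : Module k (BMod k I ρ) :=
  inferInstanceAs (Module k ((I →₀ ℤ) →₀ k))

variable {k I} in
instance (ρ : Weyl k I →ₐ[k] Module.End k ((I →₀ ℤ) →₀ k)) :
    Module (Weyl k I) (BMod k I ρ) where
  smul a x := ρ a x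
  one_smul x := by show ρ 1 x = x; rw [map_one]; rfl
  mul_smul a b x := by show ρ (a * b) x = ρ a (ρ b x); rw [map_mul]; rfl
  smul_zero a := map_zero (ρ a)
  smul_add a x y := map_add (ρ a) x y
  add_smul a b x := by show ρ (a + b) x = ρ a x + ρ b x; rw [map_add]; rfl
  zero_smul x := by show ρ 0 x = 0; rw [map_zero]; rfl

variable {k I} in
instance (ρ : Weyl k I →ₐ[k] Module.End k ((I →₀ ℤ) →₀ k)) :
    IsScalarTower k (Weyl k I) (BMod k I ρ) :=
  ⟨fun c a x => by
    show ρ (c • a) x = c • (ρ a x)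
    rw [map_smul]
    rfl⟩

/-- The basis vector `e_v` of `B(p)`. -/
def eV (ρ : Weyl k I →ₐ[k] Module.End k ((I →₀ ℤ) →₀ k)) (v : I →₀ ℤ) : BMod k I ρ :=
  Finsupp.single v 1

/-- `c` is a nonnegative integer. -/
def IsNonnegInt (c : k) : Prop := ∃ n : ℕ, c = n

/-- `c` is a negative integer. -/
def IsNegInt (c : k) : Prop := ∃ m : ℤ, m < 0 ∧ c = m

/-- Shortcut instance: quotients of the Weyl algebra by left ideals (submodules). -/
instance : HasQuotient (Weyl k I) (Submodule (Weyl k I) (Weyl k I)) :=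
  @Submodule.hasQuotient (Weyl k I) (Weyl k I) _ _ _

/-- The left ideal `J_p` of the Weyl algebra generated by the elements `t i - p i • 1`. -/
def Jp (p : I → k) : Submodule (Weyl k I) (Weyl k I) :=
  Submodule.span (Weyl k I) (Set.range fun i => tA k I i - p i • (1 : Weyl k I))

section ShiftElements

variable {k I} {A M : Type*} [Ring A] [Algebra k A] [AddCommGroup M] [Module A M] [Module k M]
  [IsScalarTower k A M]

/-- The element carrying a weight vector of weight `c` for `x * y` to its normalized
translate by `n`. -/
def shiftElt (c : k) (x y : A) : ℤ → A
  | Int.ofNat n => x ^ n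
  | Int.negSucc n => (∏ j ∈ Finset.range (n + 1), (c - j))⁻¹ • y ^ (n + 1)

lemma shiftElt_zero (c : k) (x y : A) : shiftElt c x y 0 = 1 :=
  pow_zero x

lemma shiftElt_natCast (c : k) (x y : A) (n : ℕ) : shiftElt c x y n = x ^ n := rfl

lemma shiftElt_neg_natCast (c : k) (x y : A) (n : ℕ) :
    shiftElt c x y (-n) = (∏ j ∈ Finset.range n, (c - j))⁻¹ • y ^ n := by
  cases n with
  | zero => simp [shiftElt_zero]
  | succ n => rfl

lemma commute_shiftElt {c : k} {x y a : A} (hx : Commute a x) (hy : Commute a y) (n : ℤ) :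
    Commute a (shiftElt c x y n) := by
  cases n with
  | ofNat n => exact hx.pow_right n
  | negSucc n => exact (hy.pow_right _).smul_right _

lemma smul_smul_pow_smul {c : k} {x y : A} (hxy : y * x = x * y + 1) {m : M}
    (hm : (x * y) • m = c • m) (n : ℕ) :
    (y * x) • x ^ n • m = (c + n + 1) • x ^ n • m := by
  induction n with
  | zero => simp [hxy, add_smul, hm]
  | succ n ih =>
    have h : (y * x) * x ^ (n + 1) = x * ((y * x) * x ^ n) + x ^ (n + 1) := by
      rw [hxy, pow_succ']
      have : x * y * (x * x ^ n) = x * ((y * x) * x ^ n) := by noncomm_ring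
      rw [add_mul, this, hxy, one_mul]
    rw [smul_smul, h, add_smul, mul_smul, mul_smul, ih, smul_algebra_smul_comm, smul_smul,
      ← pow_succ', Nat.cast_succ]
    generalize x ^ (n + 1) • m = z
    module

lemma mul_smul_pow_smul {c : k} {x y : A} (hxy : y * x = x * y + 1) {m : M}
    (hm : (x * y) • m = c • m) (n : ℕ) :
    (x * y) • y ^ n • m = (c - n) • y ^ n • m := by
  induction n with
  | zero => simp [hm]
  | succ n ih =>
    have h : (x * y) * y ^ (n + 1) = y * ((x * y) * y ^ n) - y ^ (n + 1) := by
      have : y * ((x * y) * y ^ n) = (y * x) * (y * y ^ n) := by noncomm_ring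
      rw [this, hxy, pow_succ', add_mul, one_mul, add_sub_cancel_right]
    rw [smul_smul, h, sub_smul, mul_smul, mul_smul, ih, smul_algebra_smul_comm, smul_smul,
      ← pow_succ', Nat.cast_succ]
    generalize y ^ (n + 1) • m = z
    module

lemma smul_shiftElt_smul {c : k} {x y : A} (hc : ∀ n : ℕ, c ≠ n) {m : M} (hxy : y * x = x * y + 1)
    (hm : (x * y) • m = c • m) (n : ℤ) :
    x • shiftElt c x y n • m = shiftElt c x y (n + 1) • m := by
  obtain ⟨n, rfl | rfl⟩ := n.eq_nat_or_neg
  · rw [← Nat.cast_succ, shiftElt_natCast, shiftElt_natCast, smul_smul, pow_succ']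
  · cases n with
    | zero => simpa [shiftElt_zero] using
        congrArg (· • m) ((shiftElt_natCast c x y 1).trans (pow_one x)).symm
    | succ n =>
      rw [show -((n + 1 : ℕ) : ℤ) + 1 = -(n : ℤ) by push_cast; ring, shiftElt_neg_natCast,
        shiftElt_neg_natCast, smul_assoc, smul_algebra_smul_comm, smul_assoc, pow_succ', mul_smul,
        ← mul_smul x y, mul_smul_pow_smul hxy hm, smul_smul, Finset.prod_range_succ, mul_inv,
        inv_mul_cancel_right₀ (sub_ne_zero.2 (hc n))]

lemma smul_shiftElt_smul' {c : k} {x y : A} (hc : ∀ n : ℕ, c ≠ n) {m : M} (hxy : y * x = x * y + 1)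
    (hm : (x * y) • m = c • m) (n : ℤ) :
    y • shiftElt c x y n • m = (c + n) • shiftElt c x y (n - 1) • m := by
  obtain ⟨n, rfl | rfl⟩ := n.eq_nat_or_neg
  · cases n with
    | zero =>
      have := shiftElt_neg_natCast c x y 1
      have hc0 : c ≠ 0 := by simpa using hc 0
      simp_all [shiftElt_zero]
    | succ n =>
      rw [show ((n + 1 : ℕ) : ℤ) - 1 = n by push_cast; ring, shiftElt_natCast, shiftElt_natCast,
        pow_succ', mul_smul, ← mul_smul y x, smul_smul_pow_smul hxy hm]
      push_cast
      rw [add_assoc]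
  · rw [show -(n : ℤ) - 1 = -((n + 1 : ℕ) : ℤ) by push_cast; ring, shiftElt_neg_natCast,
      shiftElt_neg_natCast, smul_assoc, smul_algebra_smul_comm, smul_assoc, smul_smul, smul_smul,
      ← pow_succ', Finset.prod_range_succ, mul_inv_rev, Int.cast_neg, Int.cast_natCast,
      ← sub_eq_add_neg, mul_inv_cancel_left₀ (sub_ne_zero.2 (hc n))]

end ShiftElements

section Words

/-- Families of elements satisfying the defining relations of the Weyl algebra. -/
structure WeylRelations {I A : Type*} [Ring A] (x y : I → A) : Prop where
  commute_left : ∀ i j, Commute (x i) (x j)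
  commute_right : ∀ i j, Commute (y i) (y j)
  commute : ∀ {i j}, i ≠ j → Commute (x i) (y j)
  mul_eq : ∀ i, y i * x i = x i * y i + 1

namespace WeylRelations

variable {k I} {A M : Type*} [Ring A] [Algebra k A] [AddCommGroup M] [Module A M] [Module k M]
  [IsScalarTower k A M] {x y : I → A} (h : WeylRelations x y) (p : I → k)

lemma commute_left_shiftElt (h : WeylRelations x y) {i j : I} (hij : i ≠ j) (c : k) (n : ℤ) :
    Commute (x i) (shiftElt c (x j) (y j) n) :=
  commute_shiftElt (h.commute_left i j) (h.commute hij) n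

lemma commute_right_shiftElt (h : WeylRelations x y) {i j : I} (hij : i ≠ j) (c : k) (n : ℤ) :
    Commute (y i) (shiftElt c (x j) (y j) n) :=
  commute_shiftElt (h.commute hij.symm).symm (h.commute_right i j) n

/-- The product over `i` of the elements translating by `v i` in the direction `i`. -/
def word (v : I →₀ ℤ) : A :=
  v.support.noncommProd (fun i => shiftElt (p i) (x i) (y i) (v i)) fun _ _ _ _ hij =>
    commute_shiftElt (h.commute_left_shiftElt hij.symm _ _).symm
      (h.commute_right_shiftElt hij.symm _ _).symm _

lemma word_zero : h.word p 0 = 1 := by simp [word]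

lemma word_eq_erase_mul (v : I →₀ ℤ) (i : I) :
    h.word p v = h.word p (v.erase i) * shiftElt (p i) (x i) (y i) (v i) := by
  classical
  by_cases hi : v i = 0
  · rw [hi, shiftElt_zero, mul_one, Finsupp.erase_of_notMem_support (by simpa using hi)]
  · refine (Finset.noncommProd_erase_mul _ (Finsupp.mem_support_iff.2 hi) _ _).symm.trans ?_
    congr 1
    exact Finset.noncommProd_congr (Finsupp.support_erase).symm
      (fun j hj => by rw [Finsupp.erase_ne (by rintro rfl; simp at hj)]) _

lemma commute_left_word_erase (v : I →₀ ℤ) (i : I) : Commute (x i) (h.word p (v.erase i)) :=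
  Finset.noncommProd_commute _ _ _ _ fun j hj =>
    h.commute_left_shiftElt (by rintro rfl; simp at hj) _ _

lemma commute_right_word_erase (v : I →₀ ℤ) (i : I) : Commute (y i) (h.word p (v.erase i)) :=
  Finset.noncommProd_commute _ _ _ _ fun j hj =>
    h.commute_right_shiftElt (by rintro rfl; simp at hj) _ _

variable {p} {m : M}

lemma left_smul_word_smul (hp : ∀ i (n : ℕ), p i ≠ n) (hm : ∀ i, (x i * y i) • m = p i • m)
    (v : I →₀ ℤ) (i : I) :
    x i • h.word p v • m = h.word p (v + Finsupp.single i 1) • m := by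
  rw [h.word_eq_erase_mul p v i, h.word_eq_erase_mul p (v + _) i, mul_smul, mul_smul,
    ← mul_smul (x i), (h.commute_left_word_erase p v i).eq, mul_smul,
    smul_shiftElt_smul (hp i) (h.mul_eq i) (hm i)]
  simp [Finsupp.erase_add]

lemma right_smul_word_smul (hp : ∀ i (n : ℕ), p i ≠ n) (hm : ∀ i, (x i * y i) • m = p i • m)
    (v : I →₀ ℤ) (i : I) :
    y i • h.word p v • m = (p i + (v i : k)) • h.word p (v - Finsupp.single i 1) • m := by
  rw [h.word_eq_erase_mul p v i, h.word_eq_erase_mul p (v - _) i, mul_smul, mul_smul,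
    ← mul_smul (y i), (h.commute_right_word_erase p v i).eq, mul_smul,
    smul_shiftElt_smul' (hp i) (h.mul_eq i) (hm i), smul_algebra_smul_comm]
  simp [Finsupp.erase_sub]

end WeylRelations

end Words

section BMod

variable {k I}

lemma Xop_apply (i : I) (f : MvPolynomial I k) : Xop k I i f = X i * f := rfl

lemma Yop_apply (i : I) (f : MvPolynomial I k) : Yop k I i f = pderiv i f := rfl

lemma weylRelations_op : WeylRelations (Xop k I) (Yop k I) where
  commute_left i j := LinearMap.ext fun f => by
    simp only [Module.End.mul_apply, Xop_apply, mul_left_comm]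
  commute_right i j := LinearMap.ext fun f => by
    classical
    have : ⁅pderiv (R := k) i, pderiv (R := k) j⁆ = 0 :=
      MvPolynomial.derivation_ext fun l => by
        simp [Derivation.commutator_apply, pderiv_X, Pi.single_apply, apply_ite]
    simp only [Module.End.mul_apply, Yop_apply]
    exact sub_eq_zero.1 ((Derivation.commutator_apply ..).symm.trans (DFunLike.congr_fun this f))
  commute {i j} hij := LinearMap.ext fun f => by
    simp [Module.End.mul_apply, Xop_apply, Yop_apply, pderiv_X_of_ne hij]
  mul_eq i := LinearMap.ext fun f => by
    simp [Module.End.mul_apply, Xop_apply, Yop_apply]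

lemma weylRelations : WeylRelations (XA k I) (YA k I) where
  commute_left i j := Subtype.ext (weylRelations_op.commute_left i j)
  commute_right i j := Subtype.ext (weylRelations_op.commute_right i j)
  commute hij := Subtype.ext (weylRelations_op.commute hij)
  mul_eq i := Subtype.ext (weylRelations_op.mul_eq i)

variable {ρ : Weyl k I →ₐ[k] Module.End k ((I →₀ ℤ) →₀ k)} {p : I → k}

lemma XA_smul_eV (hX : ∀ i, ρ (XA k I i) = Sop k I i) (i : I) (v : I →₀ ℤ) :
    XA k I i • eV k I ρ v = eV k I ρ (v + Finsupp.single i 1) :=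
  (LinearMap.congr_fun (hX i) _).trans Finsupp.mapDomain_single

lemma YA_smul_eV (hY : ∀ i, ρ (YA k I i) = Dop k I p i) (i : I) (v : I →₀ ℤ) :
    YA k I i • eV k I ρ v = (p i + (v i : k)) • eV k I ρ (v - Finsupp.single i 1) := by
  have h : Dop k I p i (Finsupp.single v 1) =
      (p i + (v i : k)) • (Finsupp.single (v - Finsupp.single i 1) 1 : (I →₀ ℤ) →₀ k) := by
    rw [Dop, Finsupp.lsum_single, LinearMap.toSpanSingleton_apply, one_smul]
  exact (LinearMap.congr_fun (hY i) _).trans h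

lemma tA_smul_eV_zero (hX : ∀ i, ρ (XA k I i) = Sop k I i)
    (hY : ∀ i, ρ (YA k I i) = Dop k I p i) (i : I) :
    tA k I i • eV k I ρ 0 = p i • eV k I ρ 0 := by
  rw [tA, mul_smul, YA_smul_eV hY, smul_algebra_smul_comm, XA_smul_eV hX]
  simp

lemma BMod.linearMap_ext {M : Type*} [AddCommGroup M] [Module k M] {f g : BMod k I ρ →ₗ[k] M}
    (h : ∀ v, f (eV k I ρ v) = g (eV k I ρ v)) : f = g :=
  Finsupp.lhom_ext' (M := k) fun v => LinearMap.ext_ring (h v)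

/-- If no `p i` is a natural number, then `B(p)` is generated by `e_0`. -/
lemma span_eV_zero (hp : ∀ i (n : ℕ), p i ≠ n) (hX : ∀ i, ρ (XA k I i) = Sop k I i)
    (hY : ∀ i, ρ (YA k I i) = Dop k I p i) :
    Submodule.span (Weyl k I) {eV k I ρ 0} = ⊤ := by
  set E := Submodule.span (Weyl k I) {eV k I ρ 0}
  have hadd (i : I) (n : ℤ) (v : I →₀ ℤ) (hi : v i = 0) (hv : eV k I ρ v ∈ E) :
      eV k I ρ (Finsupp.single i n + v) ∈ E := by
    induction n with
    | zero => simpa using hv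
    | succ n ih =>
      have := E.smul_mem (XA k I i) ih
      rwa [XA_smul_eV hX, add_right_comm, ← Finsupp.single_add] at this
    | pred n ih =>
      have := E.smul_mem (YA k I i) ih
      rw [YA_smul_eV hY, add_sub_right_comm, ← Finsupp.single_sub] at this
      refine ((E.restrictScalars k).smul_mem_iff ?_).1 this
      simpa [hi, ← sub_eq_add_neg, sub_eq_zero] using hp i n
  have hmem (v : I →₀ ℤ) : eV k I ρ v ∈ E := by
    induction v using Finsupp.induction with
    | zero => exact Submodule.mem_span_singleton_self _
    | single_add i n v hi _ ih => exact hadd i n v (by simpa using hi) ih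
  have : (E.restrictScalars k).mkQ = 0 :=
    BMod.linearMap_ext fun v => (Submodule.Quotient.mk_eq_zero _).2 (hmem v)
  refine eq_top_iff.2 fun z _ => ?_
  exact (Submodule.Quotient.mk_eq_zero (E.restrictScalars k)).1 (LinearMap.congr_fun this z)

/-- A `k`-linear map which commutes with the generators of the Weyl algebra is linear over it. -/
lemma map_weyl_smul {M N : Type*} [AddCommGroup M] [Module k M] [Module (Weyl k I) M]
    [IsScalarTower k (Weyl k I) M] [AddCommGroup N] [Module k N] [Module (Weyl k I) N]
    [IsScalarTower k (Weyl k I) N] (f : M →ₗ[k] N)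
    (hX : ∀ i z, f (XA k I i • z) = XA k I i • f z)
    (hY : ∀ i z, f (YA k I i • z) = YA k I i • f z) (a : Weyl k I) (z : M) :
    f (a • z) = a • f z := by
  obtain ⟨a, ha⟩ := a
  induction ha using Algebra.adjoin_induction generalizing z with
  | mem a ha =>
    obtain ⟨i, rfl⟩ | ⟨i, rfl⟩ := ha
    · exact hX i z
    · exact hY i z
  | algebraMap r =>
    change f (algebraMap k (Weyl k I) r • z) = algebraMap k (Weyl k I) r • f z
    simp
  | add a b ha hb iha ihb =>
    change f (((⟨a, ha⟩ : Weyl k I) + ⟨b, hb⟩) • z) = ((⟨a, ha⟩ : Weyl k I) + ⟨b, hb⟩) • f z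
    rw [add_smul, map_add, iha, ihb, add_smul]
  | mul a b ha hb iha ihb =>
    change f (((⟨a, ha⟩ : Weyl k I) * ⟨b, hb⟩) • z) = ((⟨a, ha⟩ : Weyl k I) * ⟨b, hb⟩) • f z
    rw [mul_smul, iha, ihb, mul_smul]

/-- If no `p i` is a natural number, then `B(p)` maps to every module containing a weight vector
of weight `p`. -/
lemma exists_linearMap_eV_zero_eq {M : Type*} [AddCommGroup M] [Module k M] [Module (Weyl k I) M]
    [IsScalarTower k (Weyl k I) M] (hp : ∀ i (n : ℕ), p i ≠ n)
    (hX : ∀ i, ρ (XA k I i) = Sop k I i) (hY : ∀ i, ρ (YA k I i) = Dop k I p i)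
    {m : M} (hm : ∀ i, tA k I i • m = p i • m) :
    ∃ f : BMod k I ρ →ₗ[Weyl k I] M, f (eV k I ρ 0) = m := by
  have hR : WeylRelations (XA k I) (YA k I) := weylRelations
  obtain ⟨f, hf⟩ : ∃ f : BMod k I ρ →ₗ[k] M, ∀ v, f (eV k I ρ v) = hR.word p v • m :=
    ⟨Finsupp.linearCombination k fun v => hR.word p v • m, fun v =>
      (Finsupp.linearCombination_single k 1 v).trans (one_smul k (hR.word p v • m))⟩
  refine ⟨{ f with map_smul' := map_weyl_smul f (fun i => ?_) fun i => ?_ }, ?_⟩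
  · refine LinearMap.congr_fun (f := f ∘ₗ Algebra.lsmul k k _ (XA k I i))
      (g := Algebra.lsmul k k M (XA k I i) ∘ₗ f) (BMod.linearMap_ext fun v => ?_)
    change f (XA k I i • eV k I ρ v) = XA k I i • f (eV k I ρ v)
    rw [XA_smul_eV hX, hf, hf, hR.left_smul_word_smul hp hm]
  · refine LinearMap.congr_fun (f := f ∘ₗ Algebra.lsmul k k _ (YA k I i))
      (g := Algebra.lsmul k k M (YA k I i) ∘ₗ f) (BMod.linearMap_ext fun v => ?_)
    change f (YA k I i • eV k I ρ v) = YA k I i • f (eV k I ρ v)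
    rw [YA_smul_eV hY, map_smul, hf, hf, hR.right_smul_word_smul hp hm]
  · exact (hf 0).trans (by rw [hR.word_zero, one_smul])

end BMod

/-- If every integral coordinate of `p` is a negative integer, then `B(p)`
is isomorphic to `P(p) = A ⧸ J_p` as modules over the Weyl algebra. -/
theorem Bp_iso_Pp [IsAlgClosed k] [CharZero k] [Infinite I] (p : I → k)
    (hp : ∀ i, (∃ m : ℤ, p i = (m : k)) → IsNegInt k (p i))
    (ρ : Weyl k I →ₐ[k] Module.End k ((I →₀ ℤ) →₀ k))
    (hX : ∀ i, ρ (XA k I i) = Sop k I i) (hY : ∀ i, ρ (YA k I i) = Dop k I p i) :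
    Nonempty ((BMod k I ρ) ≃ₗ[Weyl k I] (Weyl k I ⧸ Jp k I p)) := by
  have hp' (i : I) (n : ℕ) : p i ≠ n := fun h => by
    obtain ⟨m, hm, hpm⟩ := hp i ⟨n, by simpa using h⟩
    have : m = n := by exact_mod_cast hpm.symm.trans h
    omega
  have hle : Jp k I p ≤ LinearMap.ker (LinearMap.toSpanSingleton (Weyl k I) _ (eV k I ρ 0)) := by
    refine Submodule.span_le.2 ?_
    rintro _ ⟨i, rfl⟩
    simp [sub_smul, tA_smul_eV_zero hX hY i]
  let g := (Jp k I p).liftQ _ hle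
  have hg : g (Submodule.Quotient.mk 1) = eV k I ρ 0 := by
    simp [g]
  have hm (i : I) : tA k I i • (Submodule.Quotient.mk 1 : Weyl k I ⧸ Jp k I p) =
      p i • Submodule.Quotient.mk 1 := by
    rw [← Submodule.Quotient.mk_smul, ← Submodule.Quotient.mk_smul, Submodule.Quotient.eq,
      smul_eq_mul, mul_one]
    exact Submodule.subset_span ⟨i, rfl⟩
  obtain ⟨f, hf⟩ := exists_linearMap_eV_zero_eq hp' hX hY hm
  refine ⟨LinearEquiv.ofLinearMap f g ?_ ?_⟩
  · refine Submodule.linearMap_qext _ (LinearMap.ext_ring ?_)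
    change f (g (Submodule.Quotient.mk 1)) = Submodule.Quotient.mk 1
    rw [hg, hf]
  · refine LinearMap.ext_on (span_eV_zero hp' hX hY) ?_
    rintro _ rfl
    change g (f (eV k I ρ 0)) = eV k I ρ 0
    rw [hf, hg]
end
end

section
/- Let p : I → k be the constant function with p_i = 1 for all i. Then in the simple A-module L(p) = N/N'' (here N'' = 0, so L(p) = N): for every i ∈ I, the operator ρ_p(Y_i) acts locally nilpotently on L(p) (for each x ∈ L(p) there is n with ρ_p(Y_i)^n x = 0), yet there is no nonzero x ∈ L(p) with ρ_p(Y_i) x = 0 for all i ∈ I. -/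
set_option synthInstance.maxHeartbeats 1000000
set_option maxHeartbeats 4000000

noncomputable section

open MvPolynomial

universe u v

variable (k : Type u) (I : Type v) [Field k]

/-- The index set `S` of the submodule `N ⊆ B(p)`. -/
def Sset (p : I → k) : Set (I →₀ ℤ) :=
  {v | ∀ i, IsNonnegInt k (p i) → IsNonnegInt k (p i + ((v i : ℤ) : k))}

/-- The index set `S''` of the submodule `N'' ⊆ N`. -/
def Sset'' (p : I → k) : Set (I →₀ ℤ) :=
  {v | v ∈ Sset k I p ∧ ∃ i, IsNegInt k (p i) ∧ IsNonnegInt k (p i + ((v i : ℤ) : k))}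

/-- The `k`-span `N` of the `e_v`, `v ∈ S`. -/
def Nspan (p : I → k) (ρ : Weyl k I →ₐ[k] Module.End k ((I →₀ ℤ) →₀ k)) :
    Submodule k (BMod k I ρ) :=
  Submodule.span k {x | ∃ v ∈ Sset k I p, x = eV k I ρ v}

/-- The `k`-span `N''` of the `e_v`, `v ∈ S''`. -/
def Nspan'' (p : I → k) (ρ : Weyl k I →ₐ[k] Module.End k ((I →₀ ℤ) →₀ k)) :
    Submodule k (BMod k I ρ) :=
  Submodule.span k {x | ∃ v ∈ Sset'' k I p, x = eV k I ρ v}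

variable {k I} in
theorem Dop_single (p : I → k) (i : I) (v : I →₀ ℤ) (c : k) :
    Dop k I p i (Finsupp.single v c) =
      Finsupp.single (v - Finsupp.single i 1) (c * (p i + ((v i : ℤ) : k))) := by
  simp only [Dop, Finsupp.lsum_single, LinearMap.toSpanSingleton_apply, Finsupp.smul_single,
    smul_eq_mul, mul_one]

variable {k I} in
theorem Dop_apply (p : I → k) (i : I) (x : (I →₀ ℤ) →₀ k) (w : I →₀ ℤ) :
    Dop k I p i x w =
      x (w + Finsupp.single i 1) * (p i + ((w i + 1 : ℤ) : k)) := by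
  induction x using Finsupp.induction_linear with
  | zero => simp
  | add f g hf hg => rw [map_add, Finsupp.add_apply, hf, hg, Finsupp.add_apply, add_mul]
  | single v c =>
    rw [Dop_single]
    by_cases h : v = w + Finsupp.single i 1
    · subst h
      simp
    · rw [Finsupp.single_eq_of_ne' h, zero_mul, Finsupp.single_eq_of_ne']
      exact fun h' => h (sub_eq_iff_eq_add.mp h')

variable {k I} in
theorem Dop_pow_single_eq_zero (p : I → k) (i : I) (n : ℕ) (v : I →₀ ℤ) (c : k)
    (hv : p i + ((v i : ℤ) : k) = n) :
    (Dop k I p i ^ (n + 1)) (Finsupp.single v c) = 0 := by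
  induction n generalizing v c with
  | zero => simp [Dop_single, hv]
  | succ n ih =>
    rw [pow_succ, Module.End.mul_apply, Dop_single]
    apply ih
    have : p i + ((v i : ℤ) : k) - 1 = n := by rw [hv]; push_cast; ring
    rw [← this]
    simp
    ring

variable {k I} in
/-- If `I` is infinite and all `p i` are nonzero, no nonzero vector is killed by every `D i`. -/
theorem eq_zero_of_forall_Dop_eq_zero [Infinite I] (p : I → k) (hp : ∀ i, p i ≠ 0)
    (x : (I →₀ ℤ) →₀ k) (hx : ∀ i, Dop k I p i x = 0) : x = 0 := by
  ext v
  obtain ⟨i, hi⟩ := Infinite.exists_notMem_finset v.support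
  have h := Dop_apply p i x (v - Finsupp.single i 1)
  rw [hx i, sub_add_cancel, Finsupp.sub_apply, Finsupp.notMem_support_iff.mp hi] at h
  simpa [hp i] using h.symm

variable {k I} in
theorem Nspan''_eq_bot (p : I → k) (hp : ∀ i, ¬ IsNegInt k (p i))
    (ρ : Weyl k I →ₐ[k] Module.End k ((I →₀ ℤ) →₀ k)) : Nspan'' k I p ρ = ⊥ := by
  refine Submodule.span_eq_bot.mpr ?_
  rintro x ⟨v, ⟨-, i, hi, -⟩, -⟩
  exact absurd hi (hp i)

variable {k I} in
theorem exists_Dop_pow_eq_zero (p : I → k) (i : I) (hp : IsNonnegInt k (p i))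
    (ρ : Weyl k I →ₐ[k] Module.End k ((I →₀ ℤ) →₀ k)) (x : BMod k I ρ)
    (hx : x ∈ Nspan k I p ρ) :
    ∃ n : ℕ, (Dop k I p i ^ n) (x : (I →₀ ℤ) →₀ k) = 0 := by
  induction hx using Submodule.span_induction with
  | mem x hx =>
    obtain ⟨v, hv, rfl⟩ := hx
    obtain ⟨n, hn⟩ := hv i hp
    exact ⟨n + 1, Dop_pow_single_eq_zero p i n v 1 hn⟩
  | zero => exact ⟨0, map_zero _⟩
  | add x y _ _ hx hy =>
    obtain ⟨m, hm⟩ := hx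
    obtain ⟨n, hn⟩ := hy
    refine ⟨m + n, (map_add (Dop k I p i ^ (m + n)) _ _).trans ?_⟩
    have hx' : (Dop k I p i ^ (m + n)) (x : (I →₀ ℤ) →₀ k) = 0 :=
      Module.End.pow_map_zero_of_le (Nat.le_add_right m n) hm
    have hy' : (Dop k I p i ^ (m + n)) (y : (I →₀ ℤ) →₀ k) = 0 :=
      Module.End.pow_map_zero_of_le (Nat.le_add_left n m) hn
    rw [hx', hy', add_zero]
  | smul a x _ hx =>
    obtain ⟨n, hn⟩ := hx
    refine ⟨n, (map_smul (Dop k I p i ^ n) a _).trans ?_⟩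
    rw [hn, smul_zero]

/-- For `p` constant equal to `1`: in `L(p) = N ⧸ N''` (here `N'' = 0`)
every `Y i` acts locally nilpotently, but no nonzero vector is annihilated by all `Y i`. -/
theorem constant_one_example [IsAlgClosed k] [CharZero k] [Infinite I]
    (ρ : Weyl k I →ₐ[k] Module.End k ((I →₀ ℤ) →₀ k))
    (hX : ∀ i, ρ (XA k I i) = Sop k I i)
    (hY : ∀ i, ρ (YA k I i) = Dop k I (fun _ => 1) i)
    (NA NA'' : Submodule (Weyl k I) (BMod k I ρ))
    (hNA : (NA : Set (BMod k I ρ)) = (Nspan k I (fun _ => 1) ρ : Set (BMod k I ρ)))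
    (hNA'' : (NA'' : Set (BMod k I ρ)) =
      (Nspan'' k I (fun _ => 1) ρ : Set (BMod k I ρ))) :
    NA'' = ⊥ ∧
    (∀ (i : I) (x : NA ⧸ Submodule.comap NA.subtype NA''),
      ∃ n : ℕ, (YA k I i) ^ n • x = 0) ∧
    ¬∃ x : NA ⧸ Submodule.comap NA.subtype NA'', x ≠ 0 ∧ ∀ i, YA k I i • x = 0 := by
  have hneg : ¬ IsNegInt k (1 : k) := by
    rintro ⟨m, hm, h⟩
    have : m = 1 := by exact_mod_cast h.symm
    omega
  have hbot : NA'' = ⊥ := by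
    apply SetLike.coe_injective
    rw [hNA'', Nspan''_eq_bot _ fun _ => hneg]
    rfl
  subst hbot
  refine ⟨rfl, fun i x => ?_, ?_⟩
  · obtain ⟨⟨y, hy⟩, rfl⟩ := Submodule.Quotient.mk_surjective _ x
    have hy' : y ∈ Nspan k I (fun _ => 1) ρ := by
      rw [← SetLike.mem_coe, ← hNA]
      exact hy
    obtain ⟨n, hn⟩ := exists_Dop_pow_eq_zero (fun _ => 1) i ⟨1, by simp⟩ ρ y hy'
    refine ⟨n, ?_⟩
    refine (Submodule.Quotient.mk_smul _ _ _).symm.trans ?_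
    refine (Submodule.Quotient.mk_eq_zero _).mpr ((Submodule.mem_bot (Weyl k I)).mpr ?_)
    change ρ (YA k I i ^ n) y = 0
    rw [map_pow, hY]
    exact hn
  · rintro ⟨x, hx, hYx⟩
    obtain ⟨y, rfl⟩ := Submodule.Quotient.mk_surjective _ x
    refine hx ((Submodule.Quotient.mk_eq_zero _).mpr ((Submodule.mem_bot (Weyl k I)).mpr ?_))
    refine eq_zero_of_forall_Dop_eq_zero (fun _ => (1 : k)) (fun _ => one_ne_zero) _ fun i => ?_
    have h := (Submodule.Quotient.mk_smul _ (YA k I i) y).trans (hYx i)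
    have hmem := (Submodule.Quotient.mk_eq_zero _).mp h
    rw [Submodule.mem_comap] at hmem
    have h' := (Submodule.mem_bot (Weyl k I)).mp hmem
    rw [← hY]
    exact h'
end
end
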